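/- Let F be a field of characteristic 0 and let B be an n×n symmetric matrix over F with rank B = r. Then there exists a vector x ∈ F^n such that the (n+1)×(n+1) symmetric matrix B' with block form B' = [[B, Bx], [x^T B, x^T B x]] satisfies: (i) every quasi-principal minor of B' of order i is zero for all i with r + 1 ≤ i ≤ n + 1; (ii) for every i with 1 ≤ i ≤ r, if B has both a zero and a nonzero quasi-principal minor of order i, then so does B'; and (iii) for every i with 1 ≤ i ≤ r, if every quasi-principal minor of B of order i is nonzero, then every quasi-principal minor of B' of order i is nonzero. -/

import Mathlib

open Matrix

/-- The minor of a square matrix `B` lying in the rows indexed by `α` and the columns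
indexed by `β` (each listed in increasing order); junk value `0` if `α.card ≠ β.card`. -/
def qMinor {R : Type*} [CommRing R] {m : Type*} [Fintype m] [LinearOrder m]
    (B : Matrix m m R) (α β : Finset m) : R :=
  if h : β.card = α.card then
    (Matrix.of fun i j : Fin α.card =>
      B (α.orderEmbOfFin rfl i) (β.orderEmbOfFin h j)).det
  else 0

/-- `α` and `β` index a quasi-principal submatrix of order `k`, i.e.
`|α| = |β| = k` and `k - 1 ≤ |α ∩ β| (≤ k)`. -/
def IsQPPair {m : Type*} [DecidableEq m] (k : ℕ) (α β : Finset m) : Prop :=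
  α.card = k ∧ β.card = k ∧ k - 1 ≤ (α ∩ β).card

/-- All quasi-principal minors of `B` of order `k` are nonzero. -/
def QPAllNonzero {R : Type*} [CommRing R] {m : Type*} [Fintype m] [LinearOrder m]
    (B : Matrix m m R) (k : ℕ) : Prop :=
  ∀ α β : Finset m, IsQPPair k α β → qMinor B α β ≠ 0

/-- All quasi-principal minors of `B` of order `k` are zero. -/
def QPAllZero {R : Type*} [CommRing R] {m : Type*} [Fintype m] [LinearOrder m]
    (B : Matrix m m R) (k : ℕ) : Prop :=
  ∀ α β : Finset m, IsQPPair k α β → qMinor B α β = 0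

/-- The three possible letters of a qpr-sequence. -/
inductive QPR : Type
  | A
  | S
  | N
deriving DecidableEq

open Classical in
/-- The letter of the qpr-sequence of `B` corresponding to order `k`:
`A` if all quasi-principal minors of order `k` are nonzero, `N` if all are zero,
and `S` otherwise. -/
noncomputable def qprEntry {R : Type*} [CommRing R] {m : Type*} [Fintype m] [LinearOrder m]
    (B : Matrix m m R) (k : ℕ) : QPR :=
  if QPAllNonzero B k then QPR.A
  else if QPAllZero B k then QPR.N
  else QPR.S

/-- A sequence of letters `q 0, …, q (n-1)` (standing for `q_1 ⋯ q_n`) is attainable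
over `F` if it is the qpr-sequence of an `n × n` symmetric matrix over `F`. -/
def Attainable (F : Type*) [Field F] {n : ℕ} (q : Fin n → QPR) : Prop :=
  ∃ B : Matrix (Fin n) (Fin n) F, B.IsSymm ∧ ∀ k : Fin n, qprEntry B ((k : ℕ) + 1) = q k

/-- The Schur complement `B/B[γ] = B[γᶜ] - B[γᶜ, γ] B[γ]⁻¹ B[γ, γᶜ]`,
with rows and columns indexed by `γᶜ` (indexing inherited from `B`). -/
noncomputable def schurCompl {R : Type*} [CommRing R] {n : ℕ}
    (B : Matrix (Fin n) (Fin n) R) (γ : Finset (Fin n)) :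
    Matrix ↥(γᶜ) ↥(γᶜ) R :=
  B.submatrix (fun i : ↥(γᶜ) => (i : Fin n)) (fun j : ↥(γᶜ) => (j : Fin n)) -
    B.submatrix (fun i : ↥(γᶜ) => (i : Fin n)) (fun j : ↥γ => (j : Fin n)) *
      (B.submatrix (fun i : ↥γ => (i : Fin n)) fun j : ↥γ => (j : Fin n))⁻¹ *
      B.submatrix (fun i : ↥γ => (i : Fin n)) fun j : ↥(γᶜ) => (j : Fin n)

/-- The `(m+1) × (m+1)` matrix with block form `[[A, x], [yᵀ, b]]`. -/
def borderMat {R : Type*} [CommRing R] {m : ℕ} (A : Matrix (Fin m) (Fin m) R)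
    (x y : Fin m → R) (b : R) : Matrix (Fin (m + 1)) (Fin (m + 1)) R :=
  Matrix.of fun i j =>
    if hi : (i : ℕ) < m then
      if hj : (j : ℕ) < m then A ⟨i, hi⟩ ⟨j, hj⟩ else x ⟨i, hi⟩
    else
      if hj : (j : ℕ) < m then y ⟨j, hj⟩ else b

theorem qMinor_ne_zero_iff {F : Type*} [Field F] {m : Type*} [Fintype m] [LinearOrder m]
    (M : Matrix m m F) {k : ℕ} (f g : Fin k → m) (hf : Function.Injective f)
    (hg : Function.Injective g) :
    qMinor M (Finset.univ.image f) (Finset.univ.image g) ≠ 0 ↔ (M.submatrix f g).det ≠ 0 := by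
  have key : ∀ (α β : Finset m) (ha : α.card = k) (hb : β.card = k),
      Finset.univ.image f = α → Finset.univ.image g = β →
      (qMinor M α β ≠ 0 ↔ (M.submatrix f g).det ≠ 0) := by
    intro α β ha hb hα hβ
    subst ha
    have aux : ∀ (γ : Finset m) (hc : γ.card = α.card) (h : Fin α.card → m),
        Function.Injective h → Finset.univ.image h = γ →
        ∃ e : Equiv.Perm (Fin α.card), ∀ i, h i = γ.orderEmbOfFin hc (e i) := by
      intro γ hc h hh hγ
      have h1 : ∀ i, ∃ j, γ.orderEmbOfFin hc j = h i := by
        intro i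
        have : h i ∈ Set.range (γ.orderEmbOfFin hc) := by
          rw [Finset.range_orderEmbOfFin, ← hγ]; simp
        exact this
      choose e he using h1
      have hinj : Function.Injective e := by
        intro a b hab
        apply hh
        rw [← he, ← he, hab]
      refine ⟨Equiv.ofBijective e (Finite.injective_iff_bijective.mp hinj), fun i => ?_⟩
      simp [he]
    obtain ⟨e1, h1⟩ := aux α rfl f hf hα
    obtain ⟨e2, h2⟩ := aux β hb g hg hβ
    have : M.submatrix f g = ((Matrix.of fun i j : Fin α.card =>
      M (α.orderEmbOfFin rfl i) (β.orderEmbOfFin hb j)).submatrix e1 id).submatrix id e2 := by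
      ext i j
      simp [h1, h2]
    rw [this, Matrix.det_permute', Matrix.det_permute, qMinor, dif_pos hb]
    have s1 : ((Equiv.Perm.sign e1 : ℤ) : F) ≠ 0 := by
      rcases Int.units_eq_one_or (Equiv.Perm.sign e1) with h | h <;> simp [h]
    have s2 : ((Equiv.Perm.sign e2 : ℤ) : F) ≠ 0 := by
      rcases Int.units_eq_one_or (Equiv.Perm.sign e2) with h | h <;> simp [h]
    simp [s1, s2]
  exact key _ _ (by rw [Finset.card_image_of_injective _ hf]; simp)
    (by rw [Finset.card_image_of_injective _ hg]; simp) rfl rfl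

theorem exists_enum {m : Type*} [LinearOrder m] (α : Finset m) {k : ℕ} (h : α.card = k) :
    ∃ f : Fin k → m, Function.Injective f ∧ Finset.univ.image f = α :=
  ⟨α.orderEmbOfFin h, (α.orderEmbOfFin h).injective, by
    apply Finset.coe_injective
    simp⟩

theorem qMinor_submatrix {F : Type*} [Field F] {m m' : Type*} [Fintype m] [LinearOrder m]
    [Fintype m'] [LinearOrder m'] (M : Matrix m m F) (φ : m' → m) {k : ℕ} {α β : Finset m'}
    (ha : α.card = k) (hb : β.card = k) (h1 : Set.InjOn φ α) (h2 : Set.InjOn φ β) :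
    qMinor (M.submatrix φ φ) α β ≠ 0 ↔ qMinor M (α.image φ) (β.image φ) ≠ 0 := by
  obtain ⟨f, hf, rfl⟩ := exists_enum α ha
  obtain ⟨g, hg, rfl⟩ := exists_enum β hb
  rw [qMinor_ne_zero_iff _ f g hf hg, Finset.image_image, Finset.image_image,
    qMinor_ne_zero_iff _ (φ ∘ f) (φ ∘ g), Matrix.submatrix_submatrix]
  · intro a b hab
    exact hf (h1 (by simp) (by simp) hab)
  · intro a b hab
    exact hg (h2 (by simp) (by simp) hab)

theorem isQPPair_image {m m' : Type*} [DecidableEq m] [DecidableEq m'] (φ : m' → m) {k : ℕ}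
    {α β : Finset m'} (h : IsQPPair k α β) (h1 : Set.InjOn φ α) (h2 : Set.InjOn φ β) :
    IsQPPair k (α.image φ) (β.image φ) := by
  obtain ⟨ha, hb, hc⟩ := h
  refine ⟨by rw [Finset.card_image_of_injOn h1, ha], by rw [Finset.card_image_of_injOn h2, hb], ?_⟩
  refine hc.trans ?_
  rw [← Finset.card_image_of_injOn (s := α ∩ β) (f := φ)
    (h1.mono (by intro x hx; simp at hx; exact hx.1))]
  exact Finset.card_le_card (Finset.image_inter_subset φ α β)

/-- The factor `[I; xᵀ]`. -/
def bordP {F : Type*} [Field F] {n : ℕ} (x : Fin n → F) : Matrix (Fin (n + 1)) (Fin n) F :=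
  Matrix.of fun i => Fin.lastCases x (fun i' => Pi.single i' 1) i

theorem bord_castSucc {R : Type*} [CommRing R] {n : ℕ} (B : Matrix (Fin n) (Fin n) R)
    (x y : Fin n → R) (b : R) :
    (borderMat B x y b).submatrix Fin.castSucc Fin.castSucc = B := by
  ext i j
  simp [borderMat]

theorem bord_eq {F : Type*} [Field F] {n : ℕ} (B : Matrix (Fin n) (Fin n) F) (x : Fin n → F) :
    borderMat B (B *ᵥ x) (x ᵥ* B) (x ⬝ᵥ B *ᵥ x) = bordP x * B * (bordP x)ᵀ := by
  ext i j
  rw [Matrix.mul_assoc]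
  have h1 : ∀ i k, bordP x i k = (Fin.lastCases x (fun i' => Pi.single i' 1) i : Fin n → F) k :=
    fun _ _ => rfl
  induction i using Fin.lastCases with
  | last =>
    induction j using Fin.lastCases with
    | last => simp [borderMat, Matrix.mul_apply, h1, dotProduct, Matrix.mulVec]
    | cast j => simp [borderMat, Matrix.mul_apply, h1, Matrix.vecMul, dotProduct, Pi.single_apply]
  | cast i =>
    induction j using Fin.lastCases with
    | last => simp [borderMat, Matrix.mul_apply, h1, dotProduct, Matrix.mulVec, Pi.single_apply]
    | cast j => simp [borderMat, Matrix.mul_apply, h1, Pi.single_apply]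

theorem bord_single {F : Type*} [Field F] {n : ℕ} (B : Matrix (Fin n) (Fin n) F) (j : Fin n) :
    borderMat B (B *ᵥ Pi.single j 1) (Pi.single j 1 ᵥ* B)
      (Pi.single j (1 : F) ⬝ᵥ B *ᵥ Pi.single j 1) =
    B.submatrix (fun i => Fin.lastCases j id i) (fun i => Fin.lastCases j id i) := by
  ext i k
  induction i using Fin.lastCases with
  | last =>
    induction k using Fin.lastCases with
    | last => simp [borderMat]
    | cast k => simp [borderMat]
  | cast i =>
    induction k using Fin.lastCases with
    | last => simp [borderMat]
    | cast k => simp [borderMat]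

theorem bord_submatrix {F : Type*} [Field F] {n k : ℕ} (B : Matrix (Fin n) (Fin n) F)
    (x : Fin n → F) (f g : Fin k → Fin (n + 1)) :
    (borderMat B (B *ᵥ x) (x ᵥ* B) (x ⬝ᵥ B *ᵥ x)).submatrix f g =
      (bordP x).submatrix f id * B * ((bordP x).submatrix g id)ᵀ := by
  rw [bord_eq]
  ext i j
  simp [Matrix.mul_apply]

theorem bordP_det {F : Type*} [Field F] {n : ℕ} (f : Fin n → Fin (n + 1))
    (hf : Function.Injective f) : ((bordP (fun _ => (1 : F))).submatrix f id).det ≠ 0 := by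
  intro h0
  obtain ⟨v, hv, hv0⟩ := Matrix.exists_mulVec_eq_zero_iff.mpr h0
  apply hv
  have hz : ∃ z, z ∉ Set.range f := by
    by_contra! hall
    have := Fintype.card_le_of_surjective f hall
    simp at this
  obtain ⟨z, hz⟩ := hz
  have hr : ∀ w, w ≠ z → w ∈ Set.range f := by
    intro w hw
    by_contra hw'
    have h1 : (Finset.univ.image f) ⊆ (Finset.univ.erase w).erase z := by
      intro y hy
      simp only [Finset.mem_image, Finset.mem_univ, true_and] at hy
      obtain ⟨i, rfl⟩ := hy
      simp only [Finset.mem_erase, Finset.mem_univ, and_true]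
      exact ⟨fun h => hz ⟨i, h⟩, fun h => hw' ⟨i, h⟩⟩
    have h2 := Finset.card_le_card h1
    rw [Finset.card_image_of_injective _ hf, Finset.card_erase_of_mem (by simp [Ne.symm hw]),
      Finset.card_erase_of_mem (by simp)] at h2
    simp at h2
    omega
  have hrow : ∀ w, w ≠ z → bordP (fun _ => (1 : F)) w ⬝ᵥ v = 0 := by
    intro w hw
    obtain ⟨i, rfl⟩ := hr w hw
    exact congrFun hv0 i
  have hc : ∀ i : Fin n, i.castSucc ≠ z → v i = 0 := by
    intro i hi
    have := hrow _ hi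
    have hrw : bordP (fun _ => (1 : F)) i.castSucc = Pi.single i 1 := by
      funext k
      simp [bordP]
    rw [hrw] at this
    simpa using this
  funext i
  by_cases hi : i.castSucc = z
  · have h3 := hrow (Fin.last n) (by rw [← hi]; exact (Fin.castSucc_lt_last i).ne')
    simp only [bordP, Matrix.of_apply, Fin.lastCases_last, dotProduct, one_mul] at h3
    rw [Finset.sum_eq_single i] at h3
    · exact h3
    · intro b _ hb
      apply hc
      rw [← hi]
      exact fun h => hb (Fin.castSucc_injective _ h)
    · simp
  · exact hc i hi

theorem qMinor_map {R S : Type*} [CommRing R] [CommRing S] (φ : R →+* S) {m : Type*} [Fintype m]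
    [LinearOrder m] (M : Matrix m m R) (α β : Finset m) :
    qMinor (M.map φ) α β = φ (qMinor M α β) := by
  unfold qMinor
  split_ifs with h
  · rw [RingHom.map_det]
    rfl
  · simp

theorem exists_good {F : Type*} [Field F] {n i : ℕ} (B : Matrix (Fin n) (Fin n) F)
    (hi : i ≤ B.rank) (hA : QPAllNonzero B i) (α β : Finset (Fin (n + 1)))
    (h : IsQPPair i α β) :
    ∃ x : Fin n → F, qMinor (borderMat B (B *ᵥ x) (x ᵥ* B) (x ⬝ᵥ B *ᵥ x)) α β ≠ 0 := by
  have hrn : B.rank ≤ n := by simpa using B.rank_le_width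
  obtain ⟨ha, hb, hc⟩ := id h
  rcases (hi.trans hrn).eq_or_lt with rfl | hlt
  · refine ⟨fun _ => 1, ?_⟩
    obtain ⟨f, hf, rfl⟩ := exists_enum α ha
    obtain ⟨g, hg, rfl⟩ := exists_enum β hb
    rw [qMinor_ne_zero_iff _ f g hf hg, bord_submatrix, Matrix.det_mul, Matrix.det_mul,
      Matrix.det_transpose]
    have hBdet : B.det ≠ 0 := by
      have := hA Finset.univ Finset.univ ⟨by simp, by simp, by simp⟩
      have h2 := (qMinor_ne_zero_iff B id id Function.injective_id Function.injective_id).1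
        (by simpa using this)
      simpa using h2
    exact mul_ne_zero (mul_ne_zero (bordP_det f hf) hBdet) (bordP_det g hg)
  · have hj : ∃ j : Fin n, (Fin.last n ∈ α → j.castSucc ∉ α) ∧
        (Fin.last n ∈ β → j.castSucc ∉ β) := by
      have hz : ∃ z, z ∉ α ∪ β := by
        by_contra! hall
        have h1 : α ∪ β = Finset.univ := Finset.eq_univ_iff_forall.mpr hall
        have h2 := Finset.card_union_add_card_inter α β
        rw [h1] at h2
        simp at h2
        have h3 : i ≠ 0 := by
          rintro rfl
          omega
        omega
      obtain ⟨z, hz⟩ := hz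
      simp only [Finset.mem_union, not_or] at hz
      induction z using Fin.lastCases with
      | last => exact ⟨⟨0, by omega⟩, fun h => absurd h hz.1, fun h => absurd h hz.2⟩
      | cast z => exact ⟨z, fun _ => hz.1, fun _ => hz.2⟩
    obtain ⟨j, hj1, hj2⟩ := hj
    have inj : ∀ γ : Finset (Fin (n + 1)), (Fin.last n ∈ γ → j.castSucc ∉ γ) →
        Set.InjOn (fun i => (Fin.lastCases j id i : Fin n)) γ := by
      intro γ hγ a ha b hb hab
      simp only [Finset.mem_coe] at ha hb
      induction a using Fin.lastCases with
      | last =>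
        induction b using Fin.lastCases with
        | last => rfl
        | cast b =>
          simp at hab
          subst hab
          exact absurd hb (hγ ha)
      | cast a =>
        induction b using Fin.lastCases with
        | last =>
          simp at hab
          subst hab
          exact absurd ha (hγ hb)
        | cast b =>
          simp at hab
          rw [hab]
    refine ⟨Pi.single j 1, ?_⟩
    rw [bord_single, qMinor_submatrix _ _ ha hb (inj α hj1) (inj β hj2)]
    exact hA _ _ (isQPPair_image _ h (inj α hj1) (inj β hj2))

/-- Polynomial version of the bordered matrix. -/
noncomputable def polyBord {F : Type*} [Field F] {n : ℕ} (B : Matrix (Fin n) (Fin n) F) :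
    Matrix (Fin (n + 1)) (Fin (n + 1)) (MvPolynomial (Fin n) F) :=
  borderMat (B.map MvPolynomial.C) (B.map MvPolynomial.C *ᵥ MvPolynomial.X)
    (MvPolynomial.X ᵥ* B.map MvPolynomial.C)
    (MvPolynomial.X ⬝ᵥ B.map MvPolynomial.C *ᵥ MvPolynomial.X)

theorem polyBord_eval {F : Type*} [Field F] {n : ℕ} (B : Matrix (Fin n) (Fin n) F)
    (x : Fin n → F) :
    (polyBord B).map (MvPolynomial.eval x) =
      borderMat B (B *ᵥ x) (x ᵥ* B) (x ⬝ᵥ B *ᵥ x) := by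
  ext i j
  simp only [polyBord, borderMat, Matrix.map_apply, Matrix.of_apply]
  split_ifs <;> simp [Matrix.mulVec, Matrix.vecMul, dotProduct]

/-- for a symmetric `B` of rank `r` over a field of characteristic 0, there is
a vector `x` such that `B' = [[B, Bx], [xᵀB, xᵀBx]]` satisfies: (i) all quasi-principal
minors of `B'` of each order `i` with `r + 1 ≤ i ≤ n + 1` are zero; (ii) for `1 ≤ i ≤ r`,
if `B` has both a zero and a nonzero quasi-principal minor of order `i` then so does
`B'`; (iii) for `1 ≤ i ≤ r`, if all quasi-principal minors of `B` of order `i` are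
nonzero then so are all those of `B'`. -/
theorem stmt_8 {F : Type*} [Field F] [CharZero F] {n r : ℕ}
    (B : Matrix (Fin n) (Fin n) F) (hB : B.IsSymm) (hr : B.rank = r) :
    ∃ x : Fin n → F, ∀ B' : Matrix (Fin (n + 1)) (Fin (n + 1)) F,
      B' = borderMat B (B *ᵥ x) (x ᵥ* B) (x ⬝ᵥ B *ᵥ x) →
      (∀ i : ℕ, r + 1 ≤ i → i ≤ n + 1 → QPAllZero B' i) ∧
      (∀ i : ℕ, 1 ≤ i → i ≤ r →
        (∃ α β : Finset (Fin n), IsQPPair i α β ∧ qMinor B α β = 0) →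
        (∃ α β : Finset (Fin n), IsQPPair i α β ∧ qMinor B α β ≠ 0) →
        ((∃ α β : Finset (Fin (n + 1)), IsQPPair i α β ∧ qMinor B' α β = 0) ∧
          (∃ α β : Finset (Fin (n + 1)), IsQPPair i α β ∧ qMinor B' α β ≠ 0))) ∧
      (∀ i : ℕ, 1 ≤ i → i ≤ r → QPAllNonzero B i → QPAllNonzero B' i) := by
  classical
  let good : Finset (Fin (n + 1)) × Finset (Fin (n + 1)) → Prop := fun p =>
    ∃ x : Fin n → F, qMinor (borderMat B (B *ᵥ x) (x ᵥ* B) (x ⬝ᵥ B *ᵥ x)) p.1 p.2 ≠ 0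
  let P : MvPolynomial (Fin n) F :=
    ∏ p ∈ Finset.univ.filter good, qMinor (polyBord B) p.1 p.2
  have hP : P ≠ 0 := by
    refine Finset.prod_ne_zero_iff.mpr ?_
    rintro p hp h0
    obtain ⟨x, hx⟩ := (Finset.mem_filter.mp hp).2
    apply hx
    rw [← polyBord_eval, qMinor_map, h0, map_zero]
  have hex : ∃ x : Fin n → F, MvPolynomial.eval x P ≠ 0 := by
    by_contra! hall
    exact hP (MvPolynomial.funext (by simpa using hall))
  obtain ⟨x, hx⟩ := hex
  have hgood : ∀ α β, good (α, β) →
      qMinor (borderMat B (B *ᵥ x) (x ᵥ* B) (x ⬝ᵥ B *ᵥ x)) α β ≠ 0 := by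
    intro α β hg
    rw [← polyBord_eval, qMinor_map]
    rw [map_prod] at hx
    exact Finset.prod_ne_zero_iff.mp hx (α, β) (by simp [hg])
  refine ⟨x, ?_⟩
  rintro B' hB'
  refine ⟨?_, ?_, ?_⟩
  · rintro i hi - α β ⟨ha, hb, -⟩
    by_contra hne
    obtain ⟨f, hf, rfl⟩ := exists_enum α ha
    obtain ⟨g, hg, rfl⟩ := exists_enum β hb
    have h1 := (qMinor_ne_zero_iff _ f g hf hg).1 hne
    have h2 := Matrix.rank_of_isUnit _ ((Matrix.isUnit_iff_isUnit_det _).2 (isUnit_iff_ne_zero.2 h1))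
    rw [hB', bord_submatrix] at h2
    have h3 := (Matrix.rank_mul_le_left ((bordP x).submatrix f id * B)
      ((bordP x).submatrix g id)ᵀ).trans (Matrix.rank_mul_le_right _ B)
    rw [h2, hr, Fintype.card_fin] at h3
    omega
  · have hsub : B'.submatrix Fin.castSucc Fin.castSucc = B := by rw [hB', bord_castSucc]
    have tr : ∀ i α β, IsQPPair i α β →
        IsQPPair i (α.image Fin.castSucc) (β.image Fin.castSucc) ∧
        (qMinor B α β ≠ 0 ↔
          qMinor B' (α.image Fin.castSucc) (β.image Fin.castSucc) ≠ 0) := by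
      intro i α β h
      have h1 := (Fin.castSucc_injective n).injOn (s := (α : Set (Fin n)))
      have h2 := (Fin.castSucc_injective n).injOn (s := (β : Set (Fin n)))
      refine ⟨isQPPair_image _ h h1 h2, ?_⟩
      rw [← qMinor_submatrix B' _ h.1 h.2.1 h1 h2, hsub]
    rintro i - - ⟨α, β, h, h0⟩ ⟨α', β', h', h0'⟩
    exact ⟨⟨_, _, (tr i α β h).1, (not_iff_not.mpr (tr i α β h).2 |> fun t => by simpa [h0] using t)⟩,
      ⟨_, _, (tr i α' β' h').1, (tr i α' β' h').2.1 h0'⟩⟩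
  · intro i _ hi hA α β h
    rw [hB']
    exact hgood α β (exists_good B (hr ▸ hi) hA α β h)
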